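/- Let n ≥ 1, let a be a nonzero real number, and let u : ℝⁿ → ℝ be a positive C² function satisfying the elliptic equation Δu(x) + a·u(x)·ln u(x) = 0 for all x ∈ ℝⁿ. If a < 0 then u(x) ≥ 1 for all x ∈ ℝⁿ; if a > 0 then u(x) ≤ e^{n/2} for all x ∈ ℝⁿ. -/

import Mathlib

/-- The Laplacian of a function on Euclidean space: the sum of its second
partial derivatives (the trace of its second derivative). -/
noncomputable def laplacian {n : ℕ} (v : EuclideanSpace ℝ (Fin n) → ℝ)
    (x : EuclideanSpace ℝ (Fin n)) : ℝ :=
  ∑ i : Fin n, fderiv ℝ (fun y => fderiv ℝ v y (EuclideanSpace.single i 1)) x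
    (EuclideanSpace.single i 1)

open Filter Topology
open scoped ContDiff

namespace LogLiouville

variable {n : ℕ}

/-- Partial derivative in the `j`-th coordinate direction. -/
noncomputable def D (j : Fin n) (f : EuclideanSpace ℝ (Fin n) → ℝ) :
    EuclideanSpace ℝ (Fin n) → ℝ :=
  fun x => fderiv ℝ f x (EuclideanSpace.single j 1)

theorem laplacian_eq (v : EuclideanSpace ℝ (Fin n) → ℝ) (x : EuclideanSpace ℝ (Fin n)) :
    laplacian v x = ∑ j, D j (D j v) x := rfl

theorem D_add (j : Fin n) {f g : EuclideanSpace ℝ (Fin n) → ℝ} (hf : Differentiable ℝ f)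
    (hg : Differentiable ℝ g) : D j (fun x => f x + g x) = fun x => D j f x + D j g x := by
  funext x
  simp only [D]
  rw [fderiv_fun_add (hf x) (hg x)]; rfl

theorem D_sub (j : Fin n) {f g : EuclideanSpace ℝ (Fin n) → ℝ} (hf : Differentiable ℝ f)
    (hg : Differentiable ℝ g) : D j (fun x => f x - g x) = fun x => D j f x - D j g x := by
  funext x
  simp only [D]
  rw [fderiv_fun_sub (hf x) (hg x)]; rfl

theorem D_mul (j : Fin n) {f g : EuclideanSpace ℝ (Fin n) → ℝ} (hf : Differentiable ℝ f)
    (hg : Differentiable ℝ g) :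
    D j (fun x => f x * g x) = fun x => D j f x * g x + f x * D j g x := by
  funext x
  simp only [D]
  rw [fderiv_fun_mul (hf x) (hg x)]
  simp; ring

theorem D_const_mul (j : Fin n) (c : ℝ) {f : EuclideanSpace ℝ (Fin n) → ℝ}
    (hf : Differentiable ℝ f) : D j (fun x => c * f x) = fun x => c * D j f x := by
  funext x
  simp only [D]
  rw [fderiv_const_mul (hf x)]; rfl

theorem D_sum (j : Fin n) {f : Fin n → EuclideanSpace ℝ (Fin n) → ℝ}
    (hf : ∀ i, Differentiable ℝ (f i)) :
    D j (fun x => ∑ i, f i x) = fun x => ∑ i, D j (f i) x := by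
  funext x
  simp only [D]
  rw [fderiv_fun_sum (fun i _ => hf i x)]
  simp

theorem contDiff_D (j : Fin n) {f : EuclideanSpace ℝ (Fin n) → ℝ} {m k : WithTop ℕ∞}
    (hf : ContDiff ℝ k f) (h : m + 1 ≤ k) : ContDiff ℝ m (D j f) :=
  (hf.fderiv_right h).clm_apply contDiff_const

theorem smooth_D (j : Fin n) {f : EuclideanSpace ℝ (Fin n) → ℝ}
    (hf : ContDiff ℝ ∞ f) : ContDiff ℝ ∞ (D j f) := contDiff_D j hf (by simp)

theorem D_comm (i j : Fin n) {f : EuclideanSpace ℝ (Fin n) → ℝ} (hf : ContDiff ℝ 2 f) :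
    D i (D j f) = D j (D i f) := by
  funext x
  have hd : DifferentiableAt ℝ (fderiv ℝ f) x :=
    (hf.fderiv_right (m := 1) (by norm_num)).differentiable (by norm_num) x
  have key : ∀ v w : EuclideanSpace ℝ (Fin n),
      fderiv ℝ (fun y => fderiv ℝ f y v) x w = fderiv ℝ (fderiv ℝ f) x w v := by
    intro v w
    rw [fderiv_clm_apply hd (differentiableAt_const v)]
    simp
  have hs : IsSymmSndFDerivAt ℝ f x :=
    hf.contDiffAt.isSymmSndFDerivAt (by simp)
  simp only [D]
  change fderiv ℝ (fun y => fderiv ℝ f y _) x _ = fderiv ℝ (fun y => fderiv ℝ f y _) x _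
  rw [key, key]
  exact hs _ _

theorem second_order_one {f : ℝ → ℝ} (hf : ContDiff ℝ 2 f) (h : IsLocalMax f 0) :
    deriv (deriv f) 0 ≤ 0 := by
  by_contra! hc
  have h0 : deriv f 0 = 0 := h.deriv_eq_zero
  have hmin := isLocalMin_of_deriv_deriv_pos hc h0 hf.continuous.continuousAt
  have : f =ᶠ[𝓝 0] fun _ => f 0 := by
    filter_upwards [h, hmin] with y h1 h2
    exact le_antisymm h1 h2
  have h2 := this.deriv.deriv_eq
  simp at h2
  linarith

theorem local_max {f : EuclideanSpace ℝ (Fin n) → ℝ} (hf : ContDiff ℝ 2 f)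
    {x : EuclideanSpace ℝ (Fin n)} (h : IsLocalMax f x) (j : Fin n) :
    D j f x = 0 ∧ D j (D j f) x ≤ 0 := by
  refine ⟨by simp [D, h.fderiv_eq_zero], ?_⟩
  set e : EuclideanSpace ℝ (Fin n) := EuclideanSpace.single j 1 with he
  have hl : ∀ t : ℝ, HasDerivAt (fun t : ℝ => x + t • e) e t := by
    intro t
    simpa using ((hasDerivAt_id t).smul_const e).const_add x
  have hd : ∀ g : EuclideanSpace ℝ (Fin n) → ℝ, Differentiable ℝ g →
      deriv (fun t : ℝ => g (x + t • e)) = fun t => D j g (x + t • e) := by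
    intro g hg
    funext t
    exact ((hg _).hasFDerivAt.comp_hasDerivAt t (hl t)).deriv
  have h1 := hd f (hf.differentiable (by norm_num))
  have h2 := hd (D j f) ((contDiff_D (m := 1) j hf (by norm_num)).differentiable (by norm_num))
  have hc : ContDiff ℝ 2 (fun t : ℝ => f (x + t • e)) := by fun_prop
  have hm : IsLocalMax (fun t : ℝ => f (x + t • e)) 0 := by
    have hcont : Tendsto (fun t : ℝ => x + t • e) (𝓝 0) (𝓝 x) := by
      have : Continuous (fun t : ℝ => x + t • e) := by fun_prop
      simpa using this.tendsto 0
    have := hcont.eventually h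
    simpa [IsLocalMax, IsMaxFilter] using this
  have := second_order_one hc hm
  rw [h1, h2] at this
  simpa using this

/-- The cutoff function. -/
noncomputable def cut (R : ℝ) (x0 : EuclideanSpace ℝ (Fin n)) : EuclideanSpace ℝ (Fin n) → ℝ :=
  fun x => R ^ 2 - ‖x - x0‖ ^ 2

theorem smooth_cut (R : ℝ) (x0 : EuclideanSpace ℝ (Fin n)) : ContDiff ℝ ∞ (cut R x0) := by
  unfold cut
  exact contDiff_const.sub ((contDiff_id.sub contDiff_const).norm_sq ℝ)

theorem D_cut (R : ℝ) (x0 : EuclideanSpace ℝ (Fin n)) (j : Fin n) :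
    D j (cut R x0) = fun x => -2 * (x j - x0 j) := by
  funext x
  have h : HasFDerivAt (cut R x0) (0 - 2 • (innerSL ℝ (x - x0)).comp
      (ContinuousLinearMap.id ℝ (EuclideanSpace ℝ (Fin n)) - 0)) x :=
    (hasFDerivAt_const _ _).sub (((hasFDerivAt_id x).sub (hasFDerivAt_const _ _)).norm_sq)
  simp only [D, h.fderiv]
  simp [EuclideanSpace.inner_single_right]

theorem DD_cut (R : ℝ) (x0 : EuclideanSpace ℝ (Fin n)) (j : Fin n) :
    D j (D j (cut R x0)) = fun _ => -2 := by
  rw [D_cut]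
  funext x
  have h : HasFDerivAt (fun x : EuclideanSpace ℝ (Fin n) => -2 * (x j - x0 j))
      ((-2 : ℝ) • (EuclideanSpace.proj j : EuclideanSpace ℝ (Fin n) →L[ℝ] ℝ)) x := by
    have := ((EuclideanSpace.proj j : EuclideanSpace ℝ (Fin n) →L[ℝ] ℝ).hasFDerivAt (x := x))
    exact (this.sub_const (x0 j)).const_mul (-2)
  simp only [D, h.fderiv]
  simp

theorem norm_sq_eq (x : EuclideanSpace ℝ (Fin n)) : ‖x‖ ^ 2 = ∑ j, (x j) ^ 2 := by
  rw [EuclideanSpace.norm_sq_eq]; simp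

theorem exists_max (R : ℝ) (hR : 0 < R) (x0 : EuclideanSpace ℝ (Fin n))
    {F : EuclideanSpace ℝ (Fin n) → ℝ} (hF : Continuous F) :
    ∃ x ∈ Metric.closedBall x0 R, ∀ y ∈ Metric.closedBall x0 R,
      (cut R x0 y) ^ 2 * F y ≤ (cut R x0 x) ^ 2 * F x := by
  have := (isCompact_closedBall x0 R).exists_isMaxOn (f := fun y => (cut R x0 y) ^ 2 * F y)
    ⟨x0, by simp [hR.le]⟩
    ((((smooth_cut R x0).continuous.pow 2).mul hF).continuousOn)
  exact this

theorem cut_pos {R : ℝ} (hR : 0 < R) {x0 x : EuclideanSpace ℝ (Fin n)}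
    (hx : x ∈ Metric.closedBall x0 R) (h : cut R x0 x ≠ 0) : 0 < cut R x0 x := by
  refine lt_of_le_of_ne ?_ (Ne.symm h)
  rw [mem_closedBall_iff_norm] at hx
  have := norm_nonneg (x - x0)
  unfold cut
  nlinarith

theorem mem_nhds_of_cut {R : ℝ} (hR : 0 < R) {x0 x : EuclideanSpace ℝ (Fin n)}
    (h : 0 < cut R x0 x) : Metric.closedBall x0 R ∈ 𝓝 x := by
  have : x ∈ Metric.ball x0 R := by
    rw [mem_ball_iff_norm]
    unfold cut at h
    exact lt_of_pow_lt_pow_left₀ 2 hR.le (by linarith)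
  exact mem_of_superset (Metric.isOpen_ball.mem_nhds this) Metric.ball_subset_closedBall

theorem part_one (a : ℝ) (ha : a < 0)
    (u : EuclideanSpace ℝ (Fin n) → ℝ)
    (hpos : ∀ x, 0 < u x) (hreg : ContDiff ℝ 2 u)
    (heq : ∀ x, laplacian u x + a * u x * Real.log (u x) = 0)
    (x0 : EuclideanSpace ℝ (Fin n)) (R : ℝ) (hR : 0 < R) :
    -(2 * n * (n + 2) / (-a * R ^ 2)) ≤ Real.log (u x0) := by
  set c : ℝ := 2 * n * (n + 2) / (-a * R ^ 2) with hc
  obtain ⟨x, hxm, hx⟩ := exists_max R hR x0 (F := fun y => (u y)⁻¹)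
    (hreg.continuous.inv₀ (fun y => (hpos y).ne'))
  have hx0 := hx x0 (by simp [hR.le])
  have hc0 : cut R x0 x0 = R ^ 2 := by simp [cut]
  rw [hc0] at hx0
  have hu0 := hpos x0
  have hux := hpos x
  have hψ : 0 < cut R x0 x := by
    apply cut_pos hR hxm
    intro h0
    rw [h0] at hx0
    have : 0 < (R ^ 2) ^ 2 * (u x0)⁻¹ := by positivity
    simp at hx0
    nlinarith
  set ψ := cut R x0 with hψd
  set m := (ψ x) ^ 2 * (u x)⁻¹ with hm
  have hmpos : 0 < m := by positivity
  have hψs : ContDiff ℝ ∞ ψ := smooth_cut R x0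
  have hψdf : Differentiable ℝ ψ := hψs.differentiable (by simp)
  have hud : Differentiable ℝ u := hreg.differentiable (by norm_num)
  have hDu : ∀ j, Differentiable ℝ (D j u) := fun j =>
    (contDiff_D (m := 1) j hreg (by norm_num)).differentiable (by norm_num)
  have hDψ : ∀ j, Differentiable ℝ (D j ψ) := fun j =>
    (smooth_D j hψs).differentiable (by simp)
  have hmu : m * u x = ψ x ^ 2 := by rw [hm]; field_simp
  have hloc : IsLocalMax (fun y => ψ y * ψ y - m * u y) x := by
    filter_upwards [mem_nhds_of_cut hR hψ] with y hy
    have h1 := hx y hy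
    have hy' := hpos y
    have : ψ y ^ 2 ≤ m * u y := by
      have := mul_le_mul_of_nonneg_right h1 hy'.le
      rwa [mul_assoc, inv_mul_cancel₀ hy'.ne', mul_one] at this
    nlinarith
  have hψ2 : ContDiff ℝ 2 ψ := contDiff_infty.1 hψs 2
  have hsm : ContDiff ℝ 2 (fun y => ψ y * ψ y - m * u y) :=
    (hψ2.mul hψ2).sub (contDiff_const.mul hreg)
  have hj : ∀ j, 8 * (x j - x0 j) ^ 2 - 4 * ψ x - m * D j (D j u) x ≤ 0 := by
    intro j
    have h := (local_max hsm hloc j).2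
    rw [D_sub j (hψdf.fun_mul hψdf) (hud.const_mul m), D_mul j hψdf hψdf, D_const_mul j m hud,
      D_sub j (((hDψ j).fun_mul hψdf).fun_add (hψdf.fun_mul (hDψ j))) ((hDu j).const_mul m),
      D_add j ((hDψ j).fun_mul hψdf) (hψdf.fun_mul (hDψ j)), D_mul j (hDψ j) hψdf, D_mul j hψdf (hDψ j),
      D_const_mul j m (hDu j)] at h
    simp only [hψd, DD_cut] at h
    simp only [D_cut] at h
    linarith
  have hsum := Finset.sum_nonpos (s := Finset.univ) (fun j _ => hj j)
  rw [Finset.sum_sub_distrib, Finset.sum_sub_distrib, ← Finset.mul_sum, ← Finset.mul_sum _ _ m,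
    ← laplacian_eq] at hsum
  simp only [Finset.sum_const, Finset.card_univ, Fintype.card_fin, nsmul_eq_mul] at hsum
  have hns : ∑ j, (x j - x0 j) ^ 2 = R ^ 2 - ψ x := by
    have := norm_sq_eq (x - x0)
    simp only [hψd, cut, this]; simp
  rw [hns] at hsum
  have hlap : laplacian u x = -a * u x * Real.log (u x) := by linarith [heq x]
  have hψR : ψ x ≤ R ^ 2 := by simp only [hψd, cut]; nlinarith [norm_nonneg (x - x0)]
  have hml : m * laplacian u x = -a * ψ x ^ 2 * Real.log (u x) := by
    rw [hlap, ← hmu]; ring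
  rw [hml] at hsum
  have hn0 : (0 : ℝ) ≤ n := Nat.cast_nonneg n
  have hc0' : 0 ≤ c := by
    rw [hc]; have : 0 < -a := by linarith
    positivity
  have hcR : c * (-a * R ^ 2) = 2 * n * (n + 2) := by
    rw [hc]; exact div_mul_cancel₀ _ (mul_ne_zero (by linarith) (by positivity))
  have hlogx : -c ≤ Real.log (u x) := by
    by_contra! hlt
    have hq : 0 < -a * ψ x ^ 2 := by
      have : 0 < -a := by linarith
      positivity
    -- multiply
    have h1 : -a * ψ x ^ 2 * Real.log (u x) < -a * ψ x ^ 2 * (-c) :=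
      mul_lt_mul_of_pos_left hlt hq
    have h2 : 8 * (R ^ 2 - ψ x) - n * (4 * ψ x) + c * (-a) * ψ x ^ 2 < 0 := by nlinarith
    have hRR : 0 < R ^ 2 := by positivity
    have h3 : (8 * (R ^ 2 - ψ x) - n * (4 * ψ x)) * R ^ 2 + 2 * n * (n + 2) * ψ x ^ 2 < 0 := by
      rw [← hcR]; nlinarith
    nlinarith [sq_nonneg (2 * (R ^ 2 - ψ x) - n * ψ x), sq_nonneg (R ^ 2 - ψ x), sq_nonneg (n * ψ x),
      mul_nonneg hψ.le (sub_nonneg.2 hψR)]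
  have hm1 : m ≤ R ^ 4 * Real.exp c := by
    have h1 : (u x)⁻¹ ≤ Real.exp c := by
      rw [inv_le_comm₀ hux (Real.exp_pos c), ← Real.exp_neg]
      rwa [Real.le_log_iff_exp_le hux] at hlogx
    have h2 : ψ x ^ 2 ≤ R ^ 4 := by nlinarith
    rw [hm]
    exact mul_le_mul h2 h1 (by positivity) (by positivity)
  have h4 : R ^ 4 * (u x0)⁻¹ ≤ R ^ 4 * Real.exp c := by
    calc R ^ 4 * (u x0)⁻¹ = (R ^ 2) ^ 2 * (u x0)⁻¹ := by ring
      _ ≤ m := hx0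
      _ ≤ _ := hm1
  have h5 : (u x0)⁻¹ ≤ Real.exp c := le_of_mul_le_mul_left h4 (by positivity)
  rw [Real.le_log_iff_exp_le hu0, Real.exp_neg]
  exact inv_le_of_inv_le₀ hu0 h5

/-- `|∇w|²`. -/
noncomputable def gradSq (w : EuclideanSpace ℝ (Fin n) → ℝ) : EuclideanSpace ℝ (Fin n) → ℝ :=
  fun x => ∑ j, D j w x * D j w x

/-- The Li-Yau type quantity. -/
noncomputable def liYau (β a : ℝ) (w : EuclideanSpace ℝ (Fin n) → ℝ) :
    EuclideanSpace ℝ (Fin n) → ℝ :=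
  fun x => β * gradSq w x + a * w x

/-- The defect of the equation satisfied by `w = log u`. -/
noncomputable def defect (a : ℝ) (w : EuclideanSpace ℝ (Fin n) → ℝ) :
    EuclideanSpace ℝ (Fin n) → ℝ :=
  fun x => (∑ j, D j (D j w) x) + gradSq w x + a * w x

theorem smooth_gradSq {w : EuclideanSpace ℝ (Fin n) → ℝ} (hw : ContDiff ℝ ∞ w) :
    ContDiff ℝ ∞ (gradSq w) :=
  ContDiff.sum fun j _ => (smooth_D j hw).mul (smooth_D j hw)

theorem smooth_liYau (β a : ℝ) {w : EuclideanSpace ℝ (Fin n) → ℝ} (hw : ContDiff ℝ ∞ w) :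
    ContDiff ℝ ∞ (liYau β a w) :=
  (contDiff_const.mul (smooth_gradSq hw)).add (contDiff_const.mul hw)

theorem D_gradSq {w : EuclideanSpace ℝ (Fin n) → ℝ} (hw : ContDiff ℝ ∞ w) (i : Fin n) :
    D i (gradSq w) = fun x => ∑ j, 2 * (D j w x * D i (D j w) x) := by
  have hd : ∀ j, Differentiable ℝ (D j w) := fun j => (smooth_D j hw).differentiable (by simp)
  unfold gradSq
  rw [D_sum i (fun j => (hd j).fun_mul (hd j))]
  funext x
  refine Finset.sum_congr rfl fun j _ => ?_
  rw [D_mul i (hd j) (hd j)]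
  ring

theorem D_liYau (β a : ℝ) {w : EuclideanSpace ℝ (Fin n) → ℝ} (hw : ContDiff ℝ ∞ w) (i : Fin n) :
    D i (liYau β a w) =
      fun x => β * (∑ j, 2 * (D j w x * D i (D j w) x)) + a * D i w x := by
  have hQ : Differentiable ℝ (gradSq w) := (smooth_gradSq hw).differentiable (by simp)
  have hwd : Differentiable ℝ w := hw.differentiable (by simp)
  unfold liYau
  rw [D_add i (hQ.const_mul β) (hwd.const_mul a), D_const_mul i β hQ, D_const_mul i a hwd,
    D_gradSq hw]

theorem DD_liYau (β a : ℝ) {w : EuclideanSpace ℝ (Fin n) → ℝ} (hw : ContDiff ℝ ∞ w) (i : Fin n) :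
    D i (D i (liYau β a w)) =
      fun x => β * (∑ j, 2 * (D i (D j w) x * D i (D j w) x + D j w x * D i (D i (D j w)) x))
        + a * D i (D i w) x := by
  have hd : ∀ j, Differentiable ℝ (D j w) := fun j => (smooth_D j hw).differentiable (by simp)
  have hdd : ∀ i j, Differentiable ℝ (D i (D j w)) := fun i j =>
    (smooth_D i (smooth_D j hw)).differentiable (by simp)
  have hs : ∀ j, Differentiable ℝ (fun x => 2 * (D j w x * D i (D j w) x)) := fun j =>
    ((hd j).fun_mul (hdd i j)).const_mul 2
  have hS : Differentiable ℝ (fun x => ∑ j, 2 * (D j w x * D i (D j w) x)) :=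
    Differentiable.fun_sum fun j _ => hs j
  rw [D_liYau β a hw, D_add i (hS.const_mul β) ((hd i).const_mul a), D_const_mul i β hS,
    D_const_mul i a (hd i), D_sum i hs]
  have hs2 : ∀ j, D i (fun x => 2 * (D j w x * D i (D j w) x)) = fun x =>
      2 * (D i (D j w) x * D i (D j w) x + D j w x * D i (D i (D j w)) x) := by
    intro j
    rw [D_const_mul i 2 ((hd j).fun_mul (hdd i j)), D_mul i (hd j) (hdd i j)]
  simp only [hs2]

theorem sum_DDD (a : ℝ) {w : EuclideanSpace ℝ (Fin n) → ℝ} (hw : ContDiff ℝ ∞ w) (j : Fin n)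
    (x : EuclideanSpace ℝ (Fin n)) :
    ∑ i, D i (D i (D j w)) x =
      D j (defect a w) x - (∑ i, 2 * (D i w x * D j (D i w) x)) - a * D j w x := by
  have hdd : ∀ i, Differentiable ℝ (D i (D i w)) := fun i =>
    (smooth_D i (smooth_D i hw)).differentiable (by simp)
  have hQ : Differentiable ℝ (gradSq w) := (smooth_gradSq hw).differentiable (by simp)
  have hwd : Differentiable ℝ w := hw.differentiable (by simp)
  have hL : Differentiable ℝ (fun x => ∑ i, D i (D i w) x) :=
    Differentiable.fun_sum fun j _ => hdd j
  have h1 : ∀ i, D i (D i (D j w)) = D j (D i (D i w)) := by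
    intro i
    rw [D_comm i j (contDiff_infty.1 hw 2), D_comm i j (contDiff_infty.1 (smooth_D i hw) 2)]
  unfold defect
  rw [D_add j (hL.fun_add hQ) (hwd.const_mul a), D_add j hL hQ, D_sum j hdd, D_const_mul j a hwd,
    D_gradSq hw]
  simp only [h1]
  ring

/-- Bochner identity for the Li-Yau quantity. -/
theorem bochner (β a : ℝ) {w : EuclideanSpace ℝ (Fin n) → ℝ} (hw : ContDiff ℝ ∞ w)
    (x : EuclideanSpace ℝ (Fin n)) :
    ∑ i, D i (D i (liYau β a w)) x =
      2 * β * (∑ i, ∑ j, D i (D j w) x ^ 2) + 2 * β * (∑ j, D j w x * D j (defect a w) x)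
        - 2 * (∑ j, D j w x * D j (liYau β a w) x) + 2 * a * (1 - β) * gradSq w x
        + a * (defect a w x - liYau β a w x - (1 - β) * gradSq w x) := by
  have hL : ∑ i, D i (D i w) x = defect a w x - liYau β a w x - (1 - β) * gradSq w x := by
    simp only [defect, liYau]; ring
  set T : ℝ := ∑ j, ∑ i, D j w x * (D i w x * D j (D i w) x) with hT
  have hG : ∑ j, D j w x * D j (liYau β a w) x = 2 * β * T + a * gradSq w x := by
    simp only [D_liYau β a hw, gradSq, hT, Finset.mul_sum, mul_add, Finset.sum_add_distrib]
    congr 1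
    · refine Finset.sum_congr rfl fun j _ => Finset.sum_congr rfl fun i _ => by ring
    · refine Finset.sum_congr rfl fun j _ => by ring
  have h3 : ∑ i, ∑ j, D j w x * D i (D i (D j w)) x =
      (∑ j, D j w x * D j (defect a w) x) - 2 * T - a * gradSq w x := by
    rw [Finset.sum_comm]
    simp only [← Finset.mul_sum, sum_DDD a hw]
    simp only [gradSq, hT, Finset.mul_sum, mul_sub, Finset.sum_sub_distrib]
    congr 1
    · congr 1
      refine Finset.sum_congr rfl fun j _ => Finset.sum_congr rfl fun i _ => by ring
    · refine Finset.sum_congr rfl fun j _ => by ring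
  simp only [DD_liYau β a hw]
  rw [Finset.sum_add_distrib, ← Finset.mul_sum, ← Finset.mul_sum, hL, hG]
  have h4 : ∑ i, ∑ j, 2 * (D i (D j w) x * D i (D j w) x + D j w x * D i (D i (D j w)) x)
      = 2 * (∑ i, ∑ j, D i (D j w) x ^ 2) + 2 * ∑ i, ∑ j, D j w x * D i (D i (D j w)) x := by
    simp only [Finset.mul_sum, ← Finset.sum_add_distrib]
    refine Finset.sum_congr rfl fun j _ => Finset.sum_congr rfl fun i _ => by ring
  rw [h4, h3]
  ring

theorem max_ineq (hn : 1 ≤ n) {β a R : ℝ} (hβ : 0 < β) {w : EuclideanSpace ℝ (Fin n) → ℝ}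
    (hw : ContDiff ℝ ∞ w)
    {x0 x : EuclideanSpace ℝ (Fin n)}
    (hloc : IsLocalMax (fun y => cut R x0 y ^ 2 * liYau β a w y) x)
    (hφ : 0 < cut R x0 x) :
    cut R x0 x ^ 2 * ((2 * β / n) * (liYau β a w x + (1 - β) * gradSq w x - defect a w x) ^ 2
        + (1 - β) * a * gradSq w x - a * liYau β a w x + a * defect a w x
        + 2 * β * (∑ j, D j w x * D j (defect a w) x))
      - 8 * cut R x0 x * liYau β a w x * (∑ j, D j w x * (x j - x0 j))
      ≤ (24 * ‖x - x0‖ ^ 2 + 4 * n * cut R x0 x) * liYau β a w x := by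
  have hB := bochner β a hw x
  have hGs := smooth_liYau β a hw
  have hL : ∑ i, D i (D i w) x = defect a w x - liYau β a w x - (1 - β) * gradSq w x := by
    simp only [defect, liYau]; ring
  set G := liYau β a w with hG
  set φ := cut R x0 with hφd
  have hφs : ContDiff ℝ ∞ φ := smooth_cut R x0
  have hφdf : Differentiable ℝ φ := hφs.differentiable (by simp)
  have hGd : Differentiable ℝ G := hGs.differentiable (by simp)
  have hDφ : ∀ j, Differentiable ℝ (D j φ) := fun j => (smooth_D j hφs).differentiable (by simp)
  have hDG : ∀ j, Differentiable ℝ (D j G) := fun j => (smooth_D j hGs).differentiable (by simp)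
  have e1 : ∀ j, D j φ = fun x => -2 * (x j - x0 j) := fun j => D_cut R x0 j
  have e2 : ∀ j, D j (D j φ) = fun x => -2 := fun j => DD_cut R x0 j
  have hloc' : IsLocalMax (fun y => (φ y * φ y) * G y) x := by
    simpa only [sq] using hloc
  have hsm : ContDiff ℝ 2 (fun y => (φ y * φ y) * G y) :=
    contDiff_infty.1 ((hφs.mul hφs).mul hGs) 2
  have hφφ := hφdf.fun_mul hφdf
  have hDP : ∀ j, D j (fun y => (φ y * φ y) * G y) = fun y =>
      (D j φ y * φ y + φ y * D j φ y) * G y + (φ y * φ y) * D j G y := by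
    intro j
    rw [D_mul j hφφ hGd, D_mul j hφdf hφdf]
  have h1 : ∀ j, φ x * D j G x = 4 * (x j - x0 j) * G x := by
    intro j
    have h := (local_max hsm hloc' j).1
    rw [hDP] at h
    simp only [e1] at h
    have : φ x * (φ x * D j G x - 4 * (x j - x0 j) * G x) = 0 := by linarith
    rcases mul_eq_zero.1 this with h | h
    · exact absurd h hφ.ne'
    · linarith
  have h2 : ∀ j, φ x ^ 2 * D j (D j G) x ≤ (24 * (x j - x0 j) ^ 2 + 4 * φ x) * G x := by
    intro j
    have h := (local_max hsm hloc' j).2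
    have hA := ((hDφ j).fun_mul hφdf)
    have hA' := (hφdf.fun_mul (hDφ j))
    rw [hDP, D_add j ((hA.fun_add hA').fun_mul hGd) (hφφ.fun_mul (hDG j)),
      D_mul j (hA.fun_add hA') hGd, D_add j hA hA', D_mul j (hDφ j) hφdf, D_mul j hφdf (hDφ j),
      D_mul j hφφ (hDG j), D_mul j hφdf hφdf] at h
    simp only [e2] at h
    simp only [e1] at h
    have h3 := h1 j
    have h4 : (x j - x0 j) * (φ x * D j G x) = 4 * (x j - x0 j) ^ 2 * G x := by rw [h3]; ring
    nlinarith
  have hsum := Finset.sum_le_sum (s := Finset.univ) (fun j _ => h2 j)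
  rw [← Finset.mul_sum, ← Finset.sum_mul, Finset.sum_add_distrib, ← Finset.mul_sum] at hsum
  simp only [Finset.sum_const, Finset.card_univ, Fintype.card_fin, nsmul_eq_mul] at hsum
  have hns : ∑ j, (x j - x0 j) ^ 2 = ‖x - x0‖ ^ 2 := by
    rw [norm_sq_eq]; simp
  rw [hns, hB] at hsum
  have hX : φ x ^ 2 * (∑ j, D j w x * D j G x) =
      4 * φ x * G x * (∑ j, D j w x * (x j - x0 j)) := by
    rw [Finset.mul_sum, Finset.mul_sum]
    refine Finset.sum_congr rfl fun j _ => ?_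
    have := h1 j
    calc _ = φ x * D j w x * (φ x * D j G x) := by ring
      _ = _ := by rw [this]; ring
  have hn0 : (0 : ℝ) < n := by exact_mod_cast hn
  have hCS : (G x + (1 - β) * gradSq w x - defect a w x) ^ 2 / n ≤
      ∑ i, ∑ j, D i (D j w) x ^ 2 := by
    rw [div_le_iff₀ hn0]
    have hc := sq_sum_le_card_mul_sum_sq (s := Finset.univ) (f := fun i => D i (D i w) x)
    rw [hL] at hc
    simp only [Finset.card_univ, Fintype.card_fin] at hc
    have : ∑ i, D i (D i w) x ^ 2 ≤ ∑ i, ∑ j, D i (D j w) x ^ 2 :=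
      Finset.sum_le_sum fun i _ =>
        Finset.single_le_sum (f := fun j => D i (D j w) x ^ 2) (fun j _ => sq_nonneg _)
          (Finset.mem_univ i)
    calc _ = (defect a w x - G x - (1 - β) * gradSq w x) ^ 2 := by ring
      _ ≤ _ := hc
      _ ≤ _ := by rw [mul_comm]; gcongr
  have hCS2 : φ x ^ 2 * ((2 * β / n) * (G x + (1 - β) * gradSq w x - defect a w x) ^ 2) ≤
      φ x ^ 2 * (2 * β * ∑ i, ∑ j, D i (D j w) x ^ 2) := by
    apply mul_le_mul_of_nonneg_left _ (sq_nonneg _)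
    calc _ = 2 * β * ((G x + (1 - β) * gradSq w x - defect a w x) ^ 2 / n) := by ring
      _ ≤ _ := by gcongr
  nlinarith [hsum, hX, hCS2]

open MeasureTheory in
/-- Mollification of `f` by a normalized bump function. -/
noncomputable def mol (φ : ContDiffBump (0 : EuclideanSpace ℝ (Fin n)))
    (f : EuclideanSpace ℝ (Fin n) → ℝ) : EuclideanSpace ℝ (Fin n) → ℝ :=
  convolution (φ.normed volume) f (ContinuousLinearMap.lsmul ℝ ℝ) volume

open MeasureTheory in
theorem mol_apply (φ : ContDiffBump (0 : EuclideanSpace ℝ (Fin n)))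
    (f : EuclideanSpace ℝ (Fin n) → ℝ) (x : EuclideanSpace ℝ (Fin n)) :
    mol φ f x = ∫ t, φ.normed volume t * f (x - t) := rfl

theorem mol_smooth (φ : ContDiffBump (0 : EuclideanSpace ℝ (Fin n)))
    {f : EuclideanSpace ℝ (Fin n) → ℝ} (hf : Continuous f) : ContDiff ℝ ∞ (mol φ f) :=
  φ.hasCompactSupport_normed.contDiff_convolution_left _ φ.contDiff_normed hf.locallyIntegrable

open MeasureTheory in
theorem mol_integrable (φ : ContDiffBump (0 : EuclideanSpace ℝ (Fin n)))
    {f : EuclideanSpace ℝ (Fin n) → ℝ} (hf : Continuous f) (x : EuclideanSpace ℝ (Fin n)) :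
    Integrable (fun t => φ.normed volume t * f (x - t)) volume := by
  apply Continuous.integrable_of_hasCompactSupport
  · exact φ.continuous_normed.mul (by fun_prop)
  · exact φ.hasCompactSupport_normed.mul_right

open MeasureTheory in
theorem mol_pos (φ : ContDiffBump (0 : EuclideanSpace ℝ (Fin n)))
    {f : EuclideanSpace ℝ (Fin n) → ℝ} (hf : Continuous f) (hp : ∀ x, 0 < f x)
    (x : EuclideanSpace ℝ (Fin n)) : 0 < mol φ f x := by
  rw [mol_apply, integral_pos_iff_support_of_nonneg _ (mol_integrable φ hf x)]
  · have : Function.support (fun t => φ.normed volume t * f (x - t)) = Metric.ball 0 φ.rOut := by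
      rw [← φ.support_normed_eq (μ := volume)]
      ext t
      simp [(hp (x - t)).ne']
    rw [this]
    exact Metric.measure_ball_pos _ _ φ.rOut_pos
  · intro t
    exact mul_nonneg (φ.nonneg_normed t) (hp _).le

open MeasureTheory in
theorem D_mol (φ : ContDiffBump (0 : EuclideanSpace ℝ (Fin n)))
    {f : EuclideanSpace ℝ (Fin n) → ℝ} (hf : ContDiff ℝ 1 f) (j : Fin n) :
    D j (mol φ f) = mol φ (D j f) := by
  funext x0
  have hfc := hf.continuous
  have hf' : Continuous (fderiv ℝ f) := hf.continuous_fderiv (by norm_num)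
  obtain ⟨C, hC⟩ := (isCompact_closedBall x0 (1 + φ.rOut)).exists_bound_of_continuousOn
    hf'.continuousOn
  have hIntegrable : Integrable (fun t => φ.normed volume t • fderiv ℝ f (x0 - t)) volume := by
    apply Continuous.integrable_of_hasCompactSupport
    · exact φ.continuous_normed.smul (by fun_prop)
    · exact φ.hasCompactSupport_normed.smul_right
  have h := hasFDerivAt_integral_of_dominated_of_fderiv_le (𝕜 := ℝ) (μ := volume)
    (F := fun x t => φ.normed volume t * f (x - t))
    (F' := fun x t => φ.normed volume t • fderiv ℝ f (x - t)) (x₀ := x0)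
    (s := Metric.ball x0 1) (bound := fun t => φ.normed volume t * C)
    (Metric.ball_mem_nhds x0 one_pos)
    (Eventually.of_forall fun x => (mol_integrable φ hfc x).aestronglyMeasurable)
    (mol_integrable φ hfc x0) hIntegrable.aestronglyMeasurable
    (Eventually.of_forall fun t x hx => by
      rw [norm_smul, Real.norm_of_nonneg (φ.nonneg_normed t)]
      by_cases ht : φ.normed volume t = 0
      · simp [ht]
      · apply mul_le_mul_of_nonneg_left _ (φ.nonneg_normed t)
        apply hC
        have h1 : t ∈ Metric.ball (0 : EuclideanSpace ℝ (Fin n)) φ.rOut := by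
          rw [← φ.support_normed_eq (μ := volume)]; exact ht
        rw [mem_ball_iff_norm] at h1 hx
        rw [mem_closedBall_iff_norm]
        calc ‖x - t - x0‖ = ‖(x - x0) - (t - 0)‖ := by congr 1; abel
          _ ≤ ‖x - x0‖ + ‖t - 0‖ := norm_sub_le _ _
          _ ≤ _ := by linarith)
    (φ.integrable_normed.mul_const C)
    (Eventually.of_forall fun t x _ => by
      have h1 : HasFDerivAt (fun x => f (x - t)) (fderiv ℝ f (x - t)) x := by
        have := (hf.differentiable (by norm_num) (x - t)).hasFDerivAt.comp x
          ((hasFDerivAt_id x).sub_const t)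
        simpa [Function.comp_def] using this
      exact h1.const_mul _)
  have h2 : fderiv ℝ (mol φ f) x0 = ∫ t, φ.normed volume t • fderiv ℝ f (x0 - t) := h.fderiv
  simp only [D, h2, mol_apply]
  rw [ContinuousLinearMap.integral_apply hIntegrable]
  simp

/-- A sequence of bump functions shrinking to the origin. -/
noncomputable def bump (k : ℕ) : ContDiffBump (0 : EuclideanSpace ℝ (Fin n)) where
  rIn := 1 / ((k : ℝ) + 1) / 2
  rOut := 1 / ((k : ℝ) + 1)
  rIn_pos := by positivity
  rIn_lt_rOut := half_lt_self (by positivity)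

theorem mol_tendsto {f : EuclideanSpace ℝ (Fin n) → ℝ} (hf : Continuous f) {θ : ℕ → ℕ}
    (hθ : Tendsto θ atTop atTop) {y : ℕ → EuclideanSpace ℝ (Fin n)}
    {x : EuclideanSpace ℝ (Fin n)} (hy : Tendsto y atTop (𝓝 x)) :
    Tendsto (fun k => mol (bump (θ k)) f (y k)) atTop (𝓝 (f x)) := by
  apply ContDiffBump.convolution_tendsto_right (φ := fun k => bump (θ k)) (g := fun _ => f)
  · exact tendsto_one_div_add_atTop_nhds_zero_nat.comp hθ
  · exact Eventually.of_forall fun _ => hf.aestronglyMeasurable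
  · exact (hf.tendsto x).comp tendsto_snd
  · exact hy

theorem D_log {f : EuclideanSpace ℝ (Fin n) → ℝ} (hf : Differentiable ℝ f) (hp : ∀ x, 0 < f x)
    (j : Fin n) : D j (fun x => Real.log (f x)) = fun x => D j f x / f x := by
  funext x
  simp only [D]
  rw [((hf x).hasFDerivAt.log (hp x).ne').fderiv]
  simp [div_eq_inv_mul]

theorem D_div {f g : EuclideanSpace ℝ (Fin n) → ℝ} (hf : Differentiable ℝ f)
    (hg : Differentiable ℝ g) (hp : ∀ x, 0 < g x)
    (j : Fin n) :
    D j (fun x => f x / g x) = fun x => D j f x / g x - f x * D j g x / g x ^ 2 := by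
  have hd : Differentiable ℝ (fun x => f x / g x) := by
    intro x
    simp only [div_eq_mul_inv]
    exact (hf x).fun_mul ((hg x).fun_inv (hp x).ne')
  have h := D_mul j hd hg
  have : (fun x => f x / g x * g x) = f := by
    funext x; exact div_mul_cancel₀ _ (hp x).ne'
  rw [this] at h
  funext x
  have h' := congrFun h x
  have := (hp x).ne'
  rw [h']
  field_simp
  ring

/-- For positive `U`, the defect of `log U`. -/
theorem defect_log (a : ℝ) {U : EuclideanSpace ℝ (Fin n) → ℝ} (hU : ContDiff ℝ ∞ U)
    (hp : ∀ x, 0 < U x) :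
    defect a (fun x => Real.log (U x)) =
      fun x => (∑ j, D j (D j U) x) / U x + a * Real.log (U x) := by
  have hd : Differentiable ℝ U := hU.differentiable (by simp)
  have hDd : ∀ j, Differentiable ℝ (D j U) := fun j => (smooth_D j hU).differentiable (by simp)
  funext x
  simp only [defect, gradSq, D_log hd hp, D_div (hDd _) hd hp]
  rw [← Finset.sum_add_distrib, Finset.sum_div]
  congr 1
  refine Finset.sum_congr rfl fun j _ => ?_
  have := (hp x).ne'
  field_simp
  ring

theorem lap_mol (a : ℝ) {u : EuclideanSpace ℝ (Fin n) → ℝ} (hreg : ContDiff ℝ 2 u)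
    (heq : ∀ x, laplacian u x + a * u x * Real.log (u x) = 0)
    (φ : ContDiffBump (0 : EuclideanSpace ℝ (Fin n))) (x : EuclideanSpace ℝ (Fin n)) :
    ∑ j, D j (D j (mol φ u)) x = -a * mol φ (fun y => u y * Real.log (u y)) x := by
  have h1 : ∀ j, ContDiff ℝ 1 (D j u) := fun j => contDiff_D j hreg (by norm_num)
  have h2 : ∀ j, D j (D j (mol φ u)) = mol φ (D j (D j u)) := by
    intro j
    rw [D_mol φ (hreg.of_le (by norm_num)), D_mol φ (h1 j)]
  have h3 : ∀ j, Continuous (D j (D j u)) := fun j =>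
    (contDiff_D (m := 0) j (h1 j) (by norm_num)).continuous
  simp only [h2, mol_apply]
  rw [← MeasureTheory.integral_finsetSum _ (fun j _ => mol_integrable φ (h3 j) x),
    ← MeasureTheory.integral_const_mul]
  congr 1
  funext t
  rw [← Finset.mul_sum, ← laplacian_eq]
  have := heq (x - t)
  have h4 : laplacian u (x - t) = -a * (u (x - t) * Real.log (u (x - t))) := by linarith
  rw [h4]; ring

theorem defect_mol (a : ℝ) {u : EuclideanSpace ℝ (Fin n) → ℝ} (hreg : ContDiff ℝ 2 u)
    (hpos : ∀ x, 0 < u x)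
    (heq : ∀ x, laplacian u x + a * u x * Real.log (u x) = 0)
    (φ : ContDiffBump (0 : EuclideanSpace ℝ (Fin n))) :
    defect a (fun x => Real.log (mol φ u x)) = fun x =>
      a * (Real.log (mol φ u x) - mol φ (fun y => u y * Real.log (u y)) x / mol φ u x) := by
  rw [defect_log a (mol_smooth φ hreg.continuous) (mol_pos φ hreg.continuous hpos)]
  funext x
  rw [lap_mol a hreg heq]
  ring

theorem D_defect_mol (a : ℝ) {u : EuclideanSpace ℝ (Fin n) → ℝ} (hreg : ContDiff ℝ 2 u)
    (hpos : ∀ x, 0 < u x)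
    (heq : ∀ x, laplacian u x + a * u x * Real.log (u x) = 0)
    (φ : ContDiffBump (0 : EuclideanSpace ℝ (Fin n))) (j : Fin n) :
    D j (defect a (fun x => Real.log (mol φ u x))) = fun x =>
      a * (mol φ (D j u) x / mol φ u x
        - (mol φ (fun y => D j u y * Real.log (u y) + D j u y) x / mol φ u x
          - mol φ (fun y => u y * Real.log (u y)) x * mol φ (D j u) x / mol φ u x ^ 2)) := by
  have hud : Differentiable ℝ u := hreg.differentiable (by norm_num)
  have hc := hreg.continuous
  have hu1 : ContDiff ℝ 1 u := hreg.of_le (by norm_num)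
  have hl1 : ContDiff ℝ 1 (fun y => Real.log (u y)) := hu1.log fun y => (hpos y).ne'
  have hg1 : ContDiff ℝ 1 (fun y => u y * Real.log (u y)) := hu1.mul hl1
  have hU : Differentiable ℝ (mol φ u) := (mol_smooth φ hc).differentiable (by simp)
  have hV : Differentiable ℝ (mol φ (fun y => u y * Real.log (u y))) :=
    (mol_smooth φ hg1.continuous).differentiable (by simp)
  have hp := mol_pos φ hc hpos
  have hL : Differentiable ℝ (fun x => Real.log (mol φ u x)) := hU.log fun x => (hp x).ne'
  have hVU : Differentiable ℝ
      (fun x => mol φ (fun y => u y * Real.log (u y)) x / mol φ u x) := by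
    intro x
    simp only [div_eq_mul_inv]
    exact (hV x).fun_mul ((hU x).fun_inv (hp x).ne')
  have hDg : D j (fun y => u y * Real.log (u y)) = fun y => D j u y * Real.log (u y) + D j u y := by
    rw [D_mul j hud (hl1.differentiable (by norm_num)), D_log hud hpos]
    funext y
    have := (hpos y).ne'
    field_simp
  rw [defect_mol a hreg hpos heq, D_const_mul j a (hL.fun_sub hVU), D_sub j hL hVU,
    D_log hU hp, D_div hV hU hp, D_mol φ hu1, D_mol φ hg1, hDg]

theorem defect_tendsto (a : ℝ) {u : EuclideanSpace ℝ (Fin n) → ℝ} (hreg : ContDiff ℝ 2 u)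
    (hpos : ∀ x, 0 < u x)
    (heq : ∀ x, laplacian u x + a * u x * Real.log (u x) = 0) {θ : ℕ → ℕ}
    (hθ : Tendsto θ atTop atTop) {y : ℕ → EuclideanSpace ℝ (Fin n)}
    {x : EuclideanSpace ℝ (Fin n)} (hy : Tendsto y atTop (𝓝 x)) :
    Tendsto (fun k => defect a (fun z => Real.log (mol (bump (θ k)) u z)) (y k)) atTop (𝓝 0) ∧
    ∀ j, Tendsto (fun k => D j (defect a (fun z => Real.log (mol (bump (θ k)) u z))) (y k))
      atTop (𝓝 0) := by
  have hc := hreg.continuous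
  have hlc : Continuous (fun y => Real.log (u y)) := hc.log fun y => (hpos y).ne'
  have hu0 := (hpos x).ne'
  have t1 := mol_tendsto hc hθ hy
  have hlg : Continuous (fun y => u y * Real.log (u y)) := hc.mul hlc
  have t2 := mol_tendsto hlg hθ hy
  have t3 := t1.log hu0
  constructor
  · simp only [defect_mol a hreg hpos heq]
    have := (t3.sub (t2.div t1 hu0)).const_mul a
    have h0 : (0 : ℝ) = a * (Real.log (u x) - u x * Real.log (u x) / u x) := by
      field_simp
      ring
    rw [h0]
    exact this
  · intro j
    have hD : Continuous (D j u) := (contDiff_D (m := 1) j hreg (by norm_num)).continuous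
    have hDD : Continuous (fun y => D j u y * Real.log (u y) + D j u y) := (hD.mul hlc).add hD
    have t4 := mol_tendsto hD hθ hy
    have t5 := mol_tendsto hDD hθ hy
    simp only [D_defect_mol a hreg hpos heq]
    have := ((t4.div t1 hu0).sub ((t5.div t1 hu0).sub
      ((t2.mul t4).div (t1.pow 2) (pow_ne_zero 2 hu0)))).const_mul a
    have h0 : (0 : ℝ) = a * (D j u x / u x - ((D j u x * Real.log (u x) + D j u x) / u x
        - u x * Real.log (u x) * D j u x / u x ^ 2)) := by
      field_simp
      ring
    rw [h0]
    exact this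

theorem final_algebra {N β a R φ G Q b r : ℝ} (hN : 0 < N) (hβ : 0 < β) (hβ1 : β < 1) (ha : 0 < a)
    (hR : 0 < R) (hφ : 0 < φ) (hφR : φ ≤ R ^ 2) (hG : 0 < G) (hQ : 0 ≤ Q)
    (hr : r ^ 2 ≤ R ^ 2) (hb : b ^ 2 ≤ Q * r ^ 2)
    (h : φ ^ 2 * ((2 * β / N) * (G + (1 - β) * Q - 0) ^ 2 + (1 - β) * a * Q - a * G + a * 0
        + 2 * β * 0) - 8 * φ * G * b ≤ (24 * r ^ 2 + 4 * N * φ) * G) :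
    (2 * β / N) * (φ ^ 2 * G) ≤ a * R ^ 4 + (24 + 4 * N + 4 * N / (β * (1 - β))) * R ^ 2 := by
  have hs : 0 < 1 - β := by linarith
  set s := 1 - β with hsd
  set c := 2 * β / N with hc
  have hc0 : 0 < c := by positivity
  have hφ2 : φ ^ 2 ≤ R ^ 4 := by nlinarith
  -- lower bound of the left-hand side
  have h1 : φ ^ 2 * (c * (G ^ 2 + 2 * G * (s * Q)) - a * G) - 8 * φ * G * b ≤
      (24 * r ^ 2 + 4 * N * φ) * G := by
    refine le_trans ?_ h
    have : c * (G ^ 2 + 2 * G * (s * Q)) - a * G ≤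
        c * (G + s * Q - 0) ^ 2 + s * a * Q - a * G + a * 0 + 2 * β * 0 := by
      have h1 : 0 ≤ c * (s * Q) ^ 2 := by positivity
      have h2 : 0 ≤ s * a * Q := by positivity
      nlinarith
    have := mul_le_mul_of_nonneg_left this (sq_nonneg φ)
    linarith
  have h2 : φ ^ 2 * (c * (G + 2 * (s * Q)) - a) - 8 * φ * b ≤ 24 * r ^ 2 + 4 * N * φ := by
    have : (φ ^ 2 * (c * (G + 2 * (s * Q)) - a) - 8 * φ * b) * G ≤
      (24 * r ^ 2 + 4 * N * φ) * G := by linarith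
    exact le_of_mul_le_mul_right this hG
  -- Young inequality
  have hk : 0 < 2 * c * s := by positivity
  have hkk : 4 * N / (β * s) = 16 / (2 * c * s) := by
    rw [hc]; field_simp; norm_num
  have h3 : 8 * φ * b ≤ φ ^ 2 * (2 * c * s) * Q + 4 * N / (β * s) * R ^ 2 := by
    rw [hkk]
    set k := 2 * c * s
    have hb' : b ^ 2 ≤ Q * R ^ 2 := hb.trans (by gcongr)
    have h5 : (8 * φ * b) * (k * R ^ 2) ≤
        (φ ^ 2 * k * Q + 16 / k * R ^ 2) * (k * R ^ 2) := by
      have e : (φ ^ 2 * k * Q + 16 / k * R ^ 2) * (k * R ^ 2)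
        = φ ^ 2 * k ^ 2 * (Q * R ^ 2) + 16 * R ^ 4 := by field_simp
      rw [e]
      have : φ ^ 2 * k ^ 2 * b ^ 2 ≤ φ ^ 2 * k ^ 2 * (Q * R ^ 2) := by gcongr
      nlinarith [sq_nonneg (φ * k * b - 4 * R ^ 2)]
    exact le_of_mul_le_mul_right h5 (by positivity)
  nlinarith

theorem part_two (hn : 1 ≤ n) {a : ℝ} (ha : 0 < a)
    {u : EuclideanSpace ℝ (Fin n) → ℝ}
    (hpos : ∀ x, 0 < u x) (hreg : ContDiff ℝ 2 u)
    (heq : ∀ x, laplacian u x + a * u x * Real.log (u x) = 0)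
    (x0 : EuclideanSpace ℝ (Fin n)) (h0 : 0 < Real.log (u x0))
    {β R : ℝ} (hβ : 0 < β) (hβ1 : β < 1) (hR : 0 < R) :
    (2 * β / n) * (R ^ 4 * (a * Real.log (u x0))) ≤
      a * R ^ 4 + (24 + 4 * n + 4 * n / (β * (1 - β))) * R ^ 2 := by
  have hc := hreg.continuous
  set w : ℕ → EuclideanSpace ℝ (Fin n) → ℝ := fun k x => Real.log (mol (bump k) u x) with hw
  have hws : ∀ k, ContDiff ℝ ∞ (w k) := fun k =>
    (mol_smooth (bump k) hc).log fun x => (mol_pos (bump k) hc hpos x).ne'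
  have hDw : ∀ k j x, D j (w k) x = mol (bump k) (D j u) x / mol (bump k) u x := by
    intro k j x
    simp only [hw]
    rw [D_log ((mol_smooth (bump k) hc).differentiable (by simp)) (mol_pos (bump k) hc hpos),
      D_mol (bump k) (hreg.of_le (by norm_num))]
  choose y hyb hy using fun k => exists_max R hR x0 (smooth_liYau β a (hws k)).continuous
  obtain ⟨x, hxb, θ, hθm, hyx⟩ := (isCompact_closedBall x0 R).tendsto_subseq hyb
  have hθ : Tendsto θ atTop atTop := hθm.tendsto_atTop
  -- limits
  have hDc : ∀ j, Continuous (D j u) := fun j =>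
    (contDiff_D (m := 1) j hreg (by norm_num)).continuous
  have lim_w : ∀ (z : ℕ → EuclideanSpace ℝ (Fin n)) (p : EuclideanSpace ℝ (Fin n)),
      Tendsto z atTop (𝓝 p) →
      Tendsto (fun k => w (θ k) (z k)) atTop (𝓝 (Real.log (u p))) := fun z p hz =>
    (mol_tendsto hc hθ hz).log (hpos p).ne'
  have lim_D : ∀ (z : ℕ → EuclideanSpace ℝ (Fin n)) (p : EuclideanSpace ℝ (Fin n)),
      Tendsto z atTop (𝓝 p) → ∀ j,
      Tendsto (fun k => D j (w (θ k)) (z k)) atTop (𝓝 (D j u p / u p)) := by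
    intro z p hz j
    simp only [hDw]
    exact (mol_tendsto (hDc j) hθ hz).div (mol_tendsto hc hθ hz) (hpos p).ne'
  set q : EuclideanSpace ℝ (Fin n) → ℝ := fun p => ∑ j, (D j u p / u p) * (D j u p / u p) with hq
  have hq0 : ∀ p, 0 ≤ q p := fun p => Finset.sum_nonneg fun j _ => mul_self_nonneg _
  have lim_Q : ∀ (z : ℕ → EuclideanSpace ℝ (Fin n)) (p : EuclideanSpace ℝ (Fin n)),
      Tendsto z atTop (𝓝 p) →
      Tendsto (fun k => gradSq (w (θ k)) (z k)) atTop (𝓝 (q p)) := by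
    intro z p hz
    exact tendsto_finsetSum _ fun j _ => (lim_D z p hz j).mul (lim_D z p hz j)
  set g : EuclideanSpace ℝ (Fin n) → ℝ := fun p => β * q p + a * Real.log (u p) with hg
  have lim_G : ∀ (z : ℕ → EuclideanSpace ℝ (Fin n)) (p : EuclideanSpace ℝ (Fin n)),
      Tendsto z atTop (𝓝 p) →
      Tendsto (fun k => liYau β a (w (θ k)) (z k)) atTop (𝓝 (g p)) := by
    intro z p hz
    exact ((lim_Q z p hz).const_mul β).add ((lim_w z p hz).const_mul a)
  have hyx' : Tendsto (fun k => y (θ k)) atTop (𝓝 x) := hyx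
  have lim_φ : Tendsto (fun k => cut R x0 (y (θ k))) atTop (𝓝 (cut R x0 x)) :=
    ((smooth_cut R x0).continuous.tendsto x).comp hyx'
  have hc0 : cut R x0 x0 = R ^ 2 := by simp [cut]
  have hmax : (R ^ 2) ^ 2 * g x0 ≤ cut R x0 x ^ 2 * g x := by
    refine le_of_tendsto_of_tendsto' ((lim_G (fun _ => x0) x0 tendsto_const_nhds).const_mul _)
      ((lim_φ.pow 2).mul (lim_G _ x hyx')) fun k => ?_
    have := hy (θ k) x0 (by simp [hR.le])
    rwa [hc0] at this
  have hg0 : a * Real.log (u x0) ≤ g x0 := by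
    have := mul_nonneg hβ.le (hq0 x0)
    simp only [hg]; linarith
  have hg0' : 0 < (R ^ 2) ^ 2 * g x0 := by
    have : 0 < g x0 := lt_of_lt_of_le (by positivity) hg0
    positivity
  have hφ : 0 < cut R x0 x := by
    apply cut_pos hR hxb
    intro h
    rw [h] at hmax
    simp only [ne_eq, OfNat.ofNat_ne_zero, not_false_eq_true, zero_pow, zero_mul] at hmax
    linarith
  have hgx : 0 < g x := by
    have : 0 < cut R x0 x ^ 2 * g x := lt_of_lt_of_le hg0' hmax
    exact (pos_iff_pos_of_mul_pos this).1 (by positivity)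
  have hev : ∀ᶠ k in atTop, 0 < cut R x0 (y (θ k)) := lim_φ.eventually_const_lt hφ
  obtain ⟨ld, ldD⟩ := defect_tendsto a hreg hpos heq hθ hyx'
  have lim_coord : ∀ j, Tendsto (fun k => y (θ k) j) atTop (𝓝 (x j)) := by
    intro j
    exact ((EuclideanSpace.proj j : EuclideanSpace ℝ (Fin n) →L[ℝ] ℝ).continuous.tendsto x).comp
      hyx'
  have lim_b : Tendsto (fun k => ∑ j, D j (w (θ k)) (y (θ k)) * (y (θ k) j - x0 j)) atTop
      (𝓝 (∑ j, D j u x / u x * (x j - x0 j))) :=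
    tendsto_finsetSum _ fun j _ => (lim_D _ x hyx' j).mul ((lim_coord j).sub_const _)
  have lim_e : Tendsto (fun k => ∑ j, D j (w (θ k)) (y (θ k)) *
      D j (defect a (w (θ k))) (y (θ k))) atTop (𝓝 0) := by
    have := tendsto_finsetSum Finset.univ fun j _ => (lim_D _ x hyx' j).mul (ldD j)
    simpa using this
  have lim_r : Tendsto (fun k => ‖y (θ k) - x0‖) atTop (𝓝 ‖x - x0‖) :=
    (hyx'.sub_const x0).norm
  have lG := lim_G _ x hyx'
  have lQ := lim_Q _ x hyx'
  have key : cut R x0 x ^ 2 * ((2 * β / n) * (g x + (1 - β) * q x - 0) ^ 2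
        + (1 - β) * a * q x - a * g x + a * 0 + 2 * β * 0)
      - 8 * cut R x0 x * g x * (∑ j, D j u x / u x * (x j - x0 j))
      ≤ (24 * ‖x - x0‖ ^ 2 + 4 * n * cut R x0 x) * g x := by
    refine le_of_tendsto_of_tendsto
      (((lim_φ.pow 2).mul (((((((lG.add (lQ.const_mul (1 - β))).sub ld).pow 2).const_mul
        (2 * β / n)).add (lQ.const_mul ((1 - β) * a))).sub (lG.const_mul a)).add
        (ld.const_mul a) |>.add (lim_e.const_mul (2 * β)))).sub
        (((lim_φ.const_mul 8).mul lG).mul lim_b))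
      ((((lim_r.pow 2).const_mul 24).add (lim_φ.const_mul (4 * (n : ℝ)))).mul lG) ?_
    filter_upwards [hev] with k hk
    refine max_ineq hn hβ (hws (θ k)) ?_ hk
    filter_upwards [mem_nhds_of_cut hR hk] with z hz
    exact hy (θ k) z hz
  have hN : (0 : ℝ) < n := by exact_mod_cast hn
  have hns : ∑ j, (x j - x0 j) ^ 2 = ‖x - x0‖ ^ 2 := by
    rw [norm_sq_eq]; simp
  have hb : (∑ j, D j u x / u x * (x j - x0 j)) ^ 2 ≤ q x * ‖x - x0‖ ^ 2 := by
    have := Finset.sum_mul_sq_le_sq_mul_sq Finset.univ (fun j => D j u x / u x)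
      (fun j => x j - x0 j)
    rw [hns] at this
    simpa only [hq, ← sq] using this
  have hr : ‖x - x0‖ ^ 2 ≤ R ^ 2 := by
    rw [mem_closedBall_iff_norm] at hxb
    gcongr
  have hφR : cut R x0 x ≤ R ^ 2 := by unfold cut; nlinarith [norm_nonneg (x - x0)]
  have hfin := final_algebra hN hβ hβ1 ha hR hφ hφR hgx (hq0 x) hr hb key
  refine le_trans ?_ hfin
  apply mul_le_mul_of_nonneg_left _ (by positivity)
  refine le_trans ?_ hmax
  calc R ^ 4 * (a * Real.log (u x0)) = (R ^ 2) ^ 2 * (a * Real.log (u x0)) := by ring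
    _ ≤ _ := by gcongr

theorem le_of_forall_R {A B C : ℝ} (h : ∀ R : ℝ, 0 < R → A ≤ B + C / R ^ 2) : A ≤ B := by
  have ht : Tendsto (fun R : ℝ => B + C / R ^ 2) atTop (𝓝 (B + 0)) :=
    tendsto_const_nhds.add (tendsto_const_nhds.div_atTop (tendsto_pow_atTop (by norm_num)))
  rw [add_zero] at ht
  refine ge_of_tendsto ht ?_
  filter_upwards [eventually_gt_atTop 0] with R hR using h R hR

end LogLiouville

/-- Sharp Liouville-type bounds (part (6) of Theorem 2.5 in the Euclidean
case) for positive solutions of the elliptic logarithmic equation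
`Δu + a u ln u = 0` on `ℝⁿ`: if `a < 0` then `u ≥ 1`; if `a > 0` then
`u ≤ e^{n/2}`. -/
theorem stmt_9 (n : ℕ) (hn : 1 ≤ n) (a : ℝ) (ha : a ≠ 0)
    (u : EuclideanSpace ℝ (Fin n) → ℝ)
    (hpos : ∀ x, 0 < u x) (hreg : ContDiff ℝ 2 u)
    (heq : ∀ x, laplacian u x + a * u x * Real.log (u x) = 0) :
    (a < 0 → ∀ x, 1 ≤ u x) ∧ (0 < a → ∀ x, u x ≤ Real.exp (n / 2)) := by
  constructor
  · intro ha x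
    have h : 0 ≤ Real.log (u x) := by
      apply LogLiouville.le_of_forall_R (C := 2 * n * (n + 2) / (-a))
      intro R hR
      have := LogLiouville.part_one a ha u hpos hreg heq x R hR
      rw [div_div]
      linarith
    exact (Real.log_nonneg_iff (hpos x)).1 h
  · intro ha x
    rw [← Real.log_le_iff_le_exp (hpos x)]
    by_cases h0 : 0 < Real.log (u x)
    swap
    · push Not at h0
      exact h0.trans (by positivity)
    have hN : (0 : ℝ) < n := by exact_mod_cast hn
    have h1 : ∀ β : ℝ, 0 < β → β < 1 → β * Real.log (u x) ≤ n / 2 := by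
      intro β hβ hβ1
      have h2 : (2 * β / n) * (a * Real.log (u x)) ≤ a := by
        apply LogLiouville.le_of_forall_R (C := 24 + 4 * n + 4 * n / (β * (1 - β)))
        intro R hR
        have h := LogLiouville.part_two hn ha hpos hreg heq x h0 hβ hβ1 hR
        have hR4 : 0 < R ^ 4 := by positivity
        refine le_of_mul_le_mul_right (a := R ^ 4) ?_ hR4
        have e : (24 + 4 * n + 4 * n / (β * (1 - β))) / R ^ 2 * R ^ 4 =
            (24 + 4 * n + 4 * n / (β * (1 - β))) * R ^ 2 := by
          rw [div_mul_eq_mul_div, div_eq_iff (by positivity)]; ring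
        rw [add_mul, e]
        linarith
      have h3 : a * (β * Real.log (u x)) ≤ a * (n / 2) := by
        have e : a * (β * Real.log (u x)) = (n / 2) * ((2 * β / n) * (a * Real.log (u x))) := by
          field_simp
        rw [e]
        calc _ ≤ (n / 2 : ℝ) * a := mul_le_mul_of_nonneg_left h2 (by positivity)
          _ = _ := mul_comm _ _
      exact le_of_mul_le_mul_left h3 ha
    have ht : Filter.Tendsto (fun β : ℝ => β * Real.log (u x)) (nhdsWithin 1 (Set.Iio 1))
        (nhds (1 * Real.log (u x))) :=
      (Continuous.tendsto (by fun_prop) 1).mono_left nhdsWithin_le_nhds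
    rw [one_mul] at ht
    refine le_of_tendsto ht ?_
    filter_upwards [Ioo_mem_nhdsLT (show (0 : ℝ) < 1 by norm_num)] with β hβ
    exact h1 β hβ.1 hβ.2
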